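/- Comparison principle for viscosity solutions with strictly separated right-hand sides (Theorem 2.9(b)). Assume the Hamiltonian H = (H^j) satisfies (H0)–(H6). Let g ∈ C(Γ) with g(x) < 0 for every x ∈ Γ. Let u₁ be a viscosity supersolution of H(x,u,∂u) = 0 on Γ and u₂ a viscosity subsolution of H(x,u,∂u) = g(x) on Γ (i.e., a viscosity subsolution of the Hamiltonian (H^j − g^j)), and assume u₁(v_i) ≥ u₂(v_i) for all i ∈ I_B. Then u₁ ≥ u₂ everywhere on Γ. -/

import Mathlib

open Set

noncomputable section

/-- A finite connected topological network. -/
structure Network where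
  I : Type
  J : Type
  finI : Fintype I
  finJ : Fintype J
  neI : Nonempty I
  neJ : Nonempty J
  l : J → ℝ
  l_pos : ∀ j, 0 < l j
  s : J → I
  t : J → I
  st_ne : ∀ j, s j ≠ t j
  conn : ∀ i i' : I,
    Relation.ReflTransGen (fun a b => ∃ j, (s j = a ∧ t j = b) ∨ (s j = b ∧ t j = a)) i i'
  IB : Set I
  IB_ne : IB.Nonempty
  deg_one_bd : ∀ i : I, ({j : J | s j = i ∨ t j = i} : Set J).ncard = 1 → i ∈ IB

attribute [instance] Network.finI Network.finJ Network.neI Network.neJ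

namespace Network

open scoped Classical

variable (N : Network)

/-- The set of edges incident to the vertex `i`. -/
def Inc (i : N.I) : Set N.J := {j | N.s j = i ∨ N.t j = i}

/-- The set of transition vertices. -/
def IT : Set N.I := N.IBᶜ

/-- The signed incidence `a_{ij}`. -/
def sgn (i : N.I) (j : N.J) : ℝ := if N.s j = i then 1 else -1

/-- The parameter `y_i^j` of the vertex `i` on the edge `j`. -/
def param (i : N.I) (j : N.J) : ℝ := if N.s j = i then 0 else N.l j

/-- The edge `j` as a parameter interval. -/
def edge (j : N.J) : Set ℝ := Icc 0 (N.l j)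

/-- A family `(u^j)` of functions on the edges defines a function on the network iff
the values at each vertex agree. -/
def Compat (u : N.J → ℝ → ℝ) : Prop :=
  ∀ i : N.I, ∀ j ∈ N.Inc i, ∀ k ∈ N.Inc i, u j (N.param i j) = u k (N.param i k)

/-- `u ∈ C(Γ)`. -/
def IsCont (u : N.J → ℝ → ℝ) : Prop :=
  N.Compat u ∧ ∀ j, ContinuousOn (u j) (N.edge j)

/-- `u ∈ C²(Γ)`. -/
def IsC2 (u : N.J → ℝ → ℝ) : Prop :=
  N.Compat u ∧ ∀ j, ContDiffOn ℝ 2 (u j) (N.edge j)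

/-- First derivative `∂_j u` along the edge `j`. -/
def pd (u : N.J → ℝ → ℝ) (j : N.J) (x : ℝ) : ℝ := derivWithin (u j) (N.edge j) x

/-- Second derivative `∂²_j u` along the edge `j`. -/
def pd2 (u : N.J → ℝ → ℝ) (j : N.J) (x : ℝ) : ℝ := derivWithin (N.pd u j) (N.edge j) x

/-- Sum over the edges incident to `i`. -/
def incSum (i : N.I) (f : N.J → ℝ) : ℝ := ∑ j : N.J, if j ∈ N.Inc i then f j else 0

/-- The Kirchhoff sum `S^i_β u`. -/
def kir (β : N.I → N.J → ℝ) (u : N.J → ℝ → ℝ) (i : N.I) : ℝ :=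
  N.incSum i (fun j => β i j * N.sgn i j * N.pd u j (N.param i j))

/-- `u ∈ C²_{*,β}(Γ)`. -/
def IsC2Star (β : N.I → N.J → ℝ) (u : N.J → ℝ → ℝ) : Prop :=
  N.IsC2 u ∧ ∀ i ∈ N.IT, N.kir β u i = 0

/-- (H0): continuity of each `H^j`. -/
def H0 (H : N.J → ℝ → ℝ → ℝ → ℝ) : Prop :=
  ∀ j, ContinuousOn (fun q : ℝ × ℝ × ℝ => H j q.1 q.2.1 q.2.2)
    ((N.edge j) ×ˢ (univ : Set ℝ) ×ˢ (univ : Set ℝ))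

/-- (H1): `r ↦ H^j(x,r,p)` is nondecreasing. -/
def H1 (H : N.J → ℝ → ℝ → ℝ → ℝ) : Prop :=
  ∀ j, ∀ x ∈ N.edge j, ∀ p : ℝ, Monotone fun r => H j x r p

/-- (H3): `p ↦ H^j(v_i,r,p)` is nondecreasing on `(0,∞)` at transition vertices. -/
def H3 (H : N.J → ℝ → ℝ → ℝ → ℝ) : Prop :=
  ∀ i ∈ N.IT, ∀ j ∈ N.Inc i, ∀ r : ℝ,
    MonotoneOn (fun p => H j (N.param i j) r p) (Ioi (0 : ℝ))

/-- (H4): coercivity in `p`, uniform on bounded `r`-sets. -/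
def H4 (H : N.J → ℝ → ℝ → ℝ → ℝ) : Prop :=
  ∀ j, ∀ R : ℝ, 0 < R → ∀ A : ℝ, ∃ M : ℝ, ∀ x ∈ N.edge j, ∀ r : ℝ, |r| ≤ R →
    ∀ p : ℝ, M < |p| → A < H j x r p

/-- (H5): continuity of `H` at the transition vertices. -/
def H5 (H : N.J → ℝ → ℝ → ℝ → ℝ) : Prop :=
  ∀ i ∈ N.IT, ∀ j ∈ N.Inc i, ∀ k ∈ N.Inc i, ∀ r p : ℝ,
    H j (N.param i j) r p = H k (N.param i k) r p

/-- (H6): symmetry of `H` in `p` at the transition vertices. -/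
def H6 (H : N.J → ℝ → ℝ → ℝ → ℝ) : Prop :=
  ∀ i ∈ N.IT, ∀ j ∈ N.Inc i, ∀ r p : ℝ,
    H j (N.param i j) r p = H j (N.param i j) r (-p)

end Network

namespace Network

variable (N : Network)

/-- `u ∈ USC(Γ)`. -/
def IsUSC (u : N.J → ℝ → ℝ) : Prop :=
  N.Compat u ∧ ∀ j, UpperSemicontinuousOn (u j) (N.edge j)

/-- `u ∈ LSC(Γ)`. -/
def IsLSC (u : N.J → ℝ → ℝ) : Prop :=
  N.Compat u ∧ ∀ j, LowerSemicontinuousOn (u j) (N.edge j)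

/-- `φ` is a `(j,k)`-test function at the transition vertex `i`. -/
def IsTestJK (φ : N.J → ℝ → ℝ) (i : N.I) (j k : N.J) : Prop :=
  N.IsCont φ ∧
  DifferentiableWithinAt ℝ (φ j) (N.edge j) (N.param i j) ∧
  DifferentiableWithinAt ℝ (φ k) (N.edge k) (N.param i k) ∧
  N.sgn i j * N.pd φ j (N.param i j) + N.sgn i k * N.pd φ k (N.param i k) = 0

/-- `w` has a local maximum at the vertex `i` relative to `ē_j ∪ ē_k`. -/
def LocalMaxVertex (w : N.J → ℝ → ℝ) (i : N.I) (j k : N.J) : Prop :=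
  ∃ δ > 0, (∀ x ∈ N.edge j, |x - N.param i j| < δ → w j x ≤ w j (N.param i j)) ∧
           (∀ x ∈ N.edge k, |x - N.param i k| < δ → w k x ≤ w k (N.param i k))

/-- `w` has a local minimum at the vertex `i` relative to `ē_j ∪ ē_k`. -/
def LocalMinVertex (w : N.J → ℝ → ℝ) (i : N.I) (j k : N.J) : Prop :=
  ∃ δ > 0, (∀ x ∈ N.edge j, |x - N.param i j| < δ → w j (N.param i j) ≤ w j x) ∧
           (∀ x ∈ N.edge k, |x - N.param i k| < δ → w k (N.param i k) ≤ w k x)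

/-- `u` is a viscosity subsolution of `H(x,u,∂u) = 0` on `Γ`. -/
def IsSubsol (H : N.J → ℝ → ℝ → ℝ → ℝ) (u : N.J → ℝ → ℝ) : Prop :=
  N.IsUSC u ∧
  (∀ j : N.J, ∀ y ∈ Ioo 0 (N.l j), ∀ φ : N.J → ℝ → ℝ, N.IsCont φ →
    DifferentiableWithinAt ℝ (φ j) (N.edge j) y →
    (∃ δ > 0, ∀ x ∈ N.edge j, |x - y| < δ → u j x - φ j x ≤ u j y - φ j y) →
    H j y (u j y) (N.pd φ j y) ≤ 0) ∧
  (∀ i ∈ N.IT, ∀ j ∈ N.Inc i, ∀ k ∈ N.Inc i, j ≠ k →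
    ∀ φ : N.J → ℝ → ℝ, N.IsTestJK φ i j k →
    N.LocalMaxVertex (fun m x => u m x - φ m x) i j k →
    H j (N.param i j) (u j (N.param i j)) (N.pd φ j (N.param i j)) ≤ 0)

/-- `u` is a viscosity supersolution of `H(x,u,∂u) = 0` on `Γ`. -/
def IsSupersol (H : N.J → ℝ → ℝ → ℝ → ℝ) (u : N.J → ℝ → ℝ) : Prop :=
  N.IsLSC u ∧
  (∀ j : N.J, ∀ y ∈ Ioo 0 (N.l j), ∀ φ : N.J → ℝ → ℝ, N.IsCont φ →
    DifferentiableWithinAt ℝ (φ j) (N.edge j) y →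
    (∃ δ > 0, ∀ x ∈ N.edge j, |x - y| < δ → u j y - φ j y ≤ u j x - φ j x) →
    0 ≤ H j y (u j y) (N.pd φ j y)) ∧
  (∀ i ∈ N.IT, ∀ j ∈ N.Inc i, ∃ k ∈ N.Inc i, k ≠ j ∧
    ∀ φ : N.J → ℝ → ℝ, N.IsTestJK φ i j k →
    N.LocalMinVertex (fun m x => u m x - φ m x) i j k →
    0 ≤ H j (N.param i j) (u j (N.param i j)) (N.pd φ j (N.param i j)))

/-- `u` is a viscosity solution of `H(x,u,∂u) = 0` on `Γ`. -/
def IsViscSol (H : N.J → ℝ → ℝ → ℝ → ℝ) (u : N.J → ℝ → ℝ) : Prop :=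
  N.IsCont u ∧ N.IsSubsol H u ∧ N.IsSupersol H u

end Network

section

open Filter Topology

/-- Doubling of variables on a finite family of compact sets of reals with base points `a j`:
maximizers of the penalized functional concentrate at a base point. -/
theorem exists_seq_isMax_penalized {J : Type*} [Finite J] (F : Ultrafilter ℕ)
    (hF : (F : Filter ℕ) ≤ atTop) {E : Set J} (hE : E.Nonempty) {K : J → Set ℝ}
    (hK : ∀ j, IsCompact (K j)) {f h : J → ℝ → ℝ}
    (hf : ∀ j, UpperSemicontinuousOn (f j) (K j))
    (hh : ∀ j, LowerSemicontinuousOn (h j) (K j))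
    {a : J → ℝ} (ha : ∀ j ∈ E, a j ∈ K j) {M : ℝ}
    (hM : ∀ j ∈ E, ∀ k ∈ E, f j (a j) - h k (a k) = M)
    {D : J → J → ℝ → ℝ → ℝ} (hD : ∀ j k, Continuous fun q : ℝ × ℝ => D j k q.1 q.2)
    (hDa : ∀ j ∈ E, ∀ k ∈ E, D j k (a j) (a k) = 0)
    (hDM : ∀ j ∈ E, ∀ k ∈ E, ∀ x ∈ K j, ∀ y ∈ K k, D j k x y = 0 → f j x - h k y ≤ M)
    (hDy : ∀ j ∈ E, ∀ k ∈ E, ∀ y, D j k (a j) y = 0 → y = a k) :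
    ∃ j ∈ E, ∃ k ∈ E, ∃ x y : ℕ → ℝ,
      (∀ᶠ n : ℕ in F, x n ∈ K j ∧ y n ∈ K k ∧
        ∀ j' ∈ E, ∀ k' ∈ E, ∀ x' ∈ K j', ∀ y' ∈ K k',
          f j' x' - h k' y' - n * D j' k' x' y' ^ 2 - (x' - a j') ^ 2 ≤
            f j (x n) - h k (y n) - n * D j k (x n) (y n) ^ 2 - (x n - a j) ^ 2) ∧
      Tendsto x F (𝓝 (a j)) ∧ Tendsto y F (𝓝 (a k)) ∧
      Tendsto (fun n => f j (x n)) F (𝓝 (f j (a j))) ∧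
      Tendsto (fun n => h k (y n)) F (𝓝 (h k (a k))) := by
  let Φ : ℕ → J → J → ℝ → ℝ → ℝ := fun n j k x y =>
    f j x - h k y - n * D j k x y ^ 2 - (x - a j) ^ 2
  have h1 : ∀ n : ℕ, ∀ e ∈ E ×ˢ E, ∃ q ∈ K e.1 ×ˢ K e.2, ∀ q' ∈ K e.1 ×ˢ K e.2,
      Φ n e.1 e.2 q'.1 q'.2 ≤ Φ n e.1 e.2 q.1 q.2 := by
    rintro n ⟨j, k⟩ ⟨hj, hk⟩
    have hu : UpperSemicontinuousOn (fun q : ℝ × ℝ => f j q.1 + (- h k q.2) +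
        (- (n * D j k q.1 q.2 ^ 2) - (q.1 - a j) ^ 2)) (K j ×ˢ K k) := by
      refine (UpperSemicontinuousOn.add ?_ ?_).add ?_
      · exact (hf j).comp continuous_fst.continuousOn fun q hq => hq.1
      · refine continuous_neg.comp_lowerSemicontinuousOn_antitone
          ((hh k).comp continuous_snd.continuousOn fun q hq => hq.2) ?_
        exact fun x y hxy => neg_le_neg hxy
      · have := hD j k
        exact Continuous.continuousOn (by fun_prop) |>.upperSemicontinuousOn
    obtain ⟨q, hq, hmax⟩ := hu.exists_isMaxOn
      (Set.Nonempty.prod ⟨a j, ha j hj⟩ ⟨a k, ha k hk⟩) ((hK j).prod (hK k))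
    refine ⟨q, hq, fun q' hq' => ?_⟩
    have := isMaxOn_iff.1 hmax q' hq'
    simp only [Φ] at this ⊢
    linarith
  have h2 : ∀ n : ℕ, ∃ e ∈ E ×ˢ E, ∃ q ∈ K e.1 ×ˢ K e.2, ∀ j' ∈ E, ∀ k' ∈ E, ∀ x' ∈ K j',
      ∀ y' ∈ K k', Φ n j' k' x' y' ≤ Φ n e.1 e.2 q.1 q.2 := by
    intro n
    choose! Q hQ hQmax using h1 n
    obtain ⟨e, he, hemax⟩ := Set.exists_max_image (E ×ˢ E)
      (fun e => Φ n e.1 e.2 (Q e).1 (Q e).2) (Set.toFinite _) (hE.prod hE)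
    exact ⟨e, he, Q e, hQ e he, fun j' hj' k' hk' x' hx' y' hy' =>
      (hQmax (j', k') ⟨hj', hk'⟩ (x', y') ⟨hx', hy'⟩).trans (hemax (j', k') ⟨hj', hk'⟩)⟩
  choose e he q hq hmax using h2
  obtain ⟨⟨j, k⟩, hjk⟩ : ∃ b, ∀ᶠ n in F, e n = b :=
    Ultrafilter.eventually_exists_iff.1 (Eventually.of_forall fun n => ⟨e n, rfl⟩)
  obtain ⟨hj, hk⟩ : j ∈ E ∧ k ∈ E := by
    obtain ⟨n, hn⟩ := hjk.exists
    have := he n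
    rw [hn] at this
    exact this
  set x : ℕ → ℝ := fun n => (q n).1
  set y : ℕ → ℝ := fun n => (q n).2
  have hev : ∀ᶠ n : ℕ in F, x n ∈ K j ∧ y n ∈ K k ∧
      ∀ j' ∈ E, ∀ k' ∈ E, ∀ x' ∈ K j', ∀ y' ∈ K k',
        Φ n j' k' x' y' ≤ Φ n j k (x n) (y n) := by
    filter_upwards [hjk] with n hn
    have h3 := hq n
    have h4 := hmax n
    rw [hn] at h3 h4
    exact ⟨h3.1, h3.2, h4⟩
  obtain ⟨x₀, hx₀, hxt⟩ := (hK j).ultrafilter_le_nhds' (F.map x) (hev.mono fun n hn => hn.1)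
  obtain ⟨y₀, hy₀, hyt⟩ := (hK k).ultrafilter_le_nhds' (F.map y) (hev.mono fun n hn => hn.2.1)
  replace hxt : Tendsto x F (𝓝 x₀) := hxt
  replace hyt : Tendsto y F (𝓝 y₀) := hyt
  have hbase : ∀ᶠ n : ℕ in F, n * D j k (x n) (y n) ^ 2 + (x n - a j) ^ 2 ≤
      f j (x n) - h k (y n) - M := by
    filter_upwards [hev] with n hn
    have := hn.2.2 j hj k hk _ (ha j hj) _ (ha k hk)
    simp only [Φ, hDa j hj k hk, hM j hj k hk] at this
    linarith
  have hfx : ∀ ε > 0, ∀ᶠ n in F, f j (x n) < f j x₀ + ε := fun ε hε =>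
    (tendsto_nhdsWithin_iff.2 ⟨hxt, hev.mono fun n hn => hn.1⟩).eventually
      (hf j x₀ hx₀ _ (lt_add_of_pos_right _ hε))
  have hhy : ∀ ε > 0, ∀ᶠ n in F, h k y₀ - ε < h k (y n) := fun ε hε =>
    (tendsto_nhdsWithin_iff.2 ⟨hyt, hev.mono fun n hn => hn.2.1⟩).eventually
      (hh k y₀ hy₀ _ (sub_lt_self _ hε))
  have hD0 : D j k x₀ y₀ = 0 := by
    have hlim : Tendsto (fun n => D j k (x n) (y n) ^ 2) F (𝓝 (D j k x₀ y₀ ^ 2)) :=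
      (((hD j k).tendsto (x₀, y₀)).comp (hxt.prodMk_nhds hyt)).pow 2
    have hz : Tendsto (fun n : ℕ => (f j x₀ - h k y₀ - M + 2) / n) F (𝓝 0) :=
      (tendsto_const_div_atTop_nhds_zero_nat _).mono_left hF
    have hle : D j k x₀ y₀ ^ 2 ≤ 0 := by
      refine le_of_tendsto_of_tendsto hlim hz ?_
      filter_upwards [hbase, hfx 1 one_pos, hhy 1 one_pos, hF (eventually_gt_atTop 0)]
        with n h1 h2 h3 h4
      have h5 : (0 : ℝ) < n := by exact_mod_cast h4
      rw [le_div_iff₀ h5]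
      nlinarith [sq_nonneg (x n - a j)]
    exact pow_eq_zero_iff two_ne_zero |>.1 (le_antisymm hle (sq_nonneg _))
  have hxa : x₀ = a j := by
    have hle : (x₀ - a j) ^ 2 ≤ 0 := by
      refine le_of_forall_pos_le_add fun ε hε => ?_
      refine le_of_tendsto ((hxt.sub_const (a j)).pow 2) ?_
      filter_upwards [hbase, hfx (ε / 2) (by positivity), hhy (ε / 2) (by positivity)]
        with n h1 h2 h3
      have h4 := hDM j hj k hk _ hx₀ _ hy₀ hD0
      have h5 : (0 : ℝ) ≤ n * D j k (x n) (y n) ^ 2 := by positivity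
      linarith
    exact sub_eq_zero.1 (pow_eq_zero_iff two_ne_zero |>.1 (le_antisymm hle (sq_nonneg _)))
  subst hxa
  have hya : y₀ = a k := hDy j hj k hk _ hD0
  subst hya
  have hMeq := hM j hj k hk
  have hlow : ∀ᶠ n : ℕ in F, M + h k (y n) ≤ f j (x n) := by
    filter_upwards [hbase] with n h1
    have h5 : (0 : ℝ) ≤ n * D j k (x n) (y n) ^ 2 := by positivity
    nlinarith [sq_nonneg (x n - a j)]
  refine ⟨j, hj, k, hk, x, y, hev, hxt, hyt, ?_, ?_⟩
  · refine tendsto_order.2 ⟨fun c hc => ?_, fun c hc => ?_⟩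
    · filter_upwards [hlow, hhy (f j (a j) - c) (by linarith)] with n h1 h2
      linarith
    · filter_upwards [hfx (c - f j (a j)) (by linarith)] with n h1
      linarith
  · refine tendsto_order.2 ⟨fun c hc => ?_, fun c hc => ?_⟩
    · filter_upwards [hhy (h k (a k) - c) (by linarith)] with n h1
      linarith
    · filter_upwards [hlow, hfx (c - h k (a k)) (by linarith)] with n h1 h2
      linarith

/-- A continuous cutoff at `a` vanishing at the endpoints of `[0, l]` other than `a`. -/
theorem exists_cutoff_endpoints (a l : ℝ) : ∃ χ : ℝ → ℝ, Continuous χ ∧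
    (∀ᶠ x in 𝓝 a, χ x = 1) ∧ (a ≠ 0 → χ 0 = 0) ∧ (a ≠ l → χ l = 0) := by
  obtain ⟨r, hr, h0, hl⟩ : ∃ r > 0, (a ≠ 0 → r ≤ dist 0 a) ∧ (a ≠ l → r ≤ dist l a) := by
    refine ⟨min (if a = 0 then 1 else dist 0 a) (if a = l then 1 else dist l a), ?_, ?_, ?_⟩
    · refine lt_min ?_ ?_ <;> split_ifs with h
      exacts [one_pos, dist_pos.2 (Ne.symm h), one_pos, dist_pos.2 (Ne.symm h)]
    · intro h
      simp [h]
    · intro h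
      simp [h]
  let χ : ContDiffBump a := ⟨r / 2, r, by positivity, by linarith⟩
  exact ⟨χ, χ.continuous, χ.eventuallyEq_one, fun h => χ.zero_of_le_dist (h0 h),
    fun h => χ.zero_of_le_dist (hl h)⟩

namespace Network

variable {N : Network}

theorem sgn_mul_self (i : N.I) (j : N.J) : N.sgn i j * N.sgn i j = 1 := by
  unfold sgn
  split_ifs <;> norm_num

theorem param_eq_or (i : N.I) (j : N.J) : N.param i j = 0 ∨ N.param i j = N.l j := by
  unfold param
  split_ifs <;> simp

theorem param_mem_edge (i : N.I) (j : N.J) : N.param i j ∈ N.edge j := by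
  have := N.l_pos j
  rcases param_eq_or i j with h | h <;> rw [h] <;> constructor <;> linarith

theorem sgn_mul_sub_param_nonneg (i : N.I) {j : N.J} {x : ℝ} (hx : x ∈ N.edge j) :
    0 ≤ N.sgn i j * (x - N.param i j) := by
  obtain ⟨h0, hl⟩ := hx
  unfold sgn param
  split_ifs <;> linarith

/-- Near a vertex, every point of an edge other than the vertex is interior. -/
theorem eventually_eq_param_or_mem_Ioo (i : N.I) (j : N.J) :
    ∀ᶠ x in 𝓝 (N.param i j), x ∈ N.edge j → x = N.param i j ∨ x ∈ Ioo 0 (N.l j) := by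
  have hl := N.l_pos j
  rcases param_eq_or i j with h | h <;> rw [h]
  · filter_upwards [eventually_lt_nhds hl] with x hx hxe
    rcases hxe.1.eq_or_lt with h0 | h0
    exacts [Or.inl h0.symm, Or.inr ⟨h0, hx⟩]
  · filter_upwards [eventually_gt_nhds hl] with x hx hxe
    rcases hxe.2.eq_or_lt with h0 | h0
    exacts [Or.inl h0, Or.inr ⟨hx, h0⟩]

open scoped Classical in
/-- Local extension of functions on some edges to a continuous function on the network. -/
theorem exists_isCont_eventuallyEq (S : Set N.J) (a : N.J → ℝ) {ψ : N.J → ℝ → ℝ} (v : ℝ)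
    (hψ : ∀ m, Continuous (ψ m)) (h0 : ∀ m ∈ S, a m = 0 → ψ m 0 = v)
    (hl : ∀ m ∈ S, a m = N.l m → ψ m (N.l m) = v) :
    ∃ φ, N.IsCont φ ∧ ∀ m ∈ S, φ m =ᶠ[𝓝 (a m)] ψ m := by
  choose χ hχc hχ1 hχ0 hχl using fun m => exists_cutoff_endpoints (a m) (N.l m)
  have hv : ∀ i j, (if j ∈ S then
      v + (ψ j (N.param i j) - v) * χ j (N.param i j) else v) = v := by
    intro i j
    split_ifs with hj
    · rcases param_eq_or i j with h | h <;> rw [h]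
      · by_cases ha : a j = 0
        · simp [h0 j hj ha]
        · simp [hχ0 j ha]
      · by_cases ha : a j = N.l j
        · simp [hl j hj ha]
        · simp [hχl j ha]
    · rfl
  refine ⟨fun m x => if m ∈ S then v + (ψ m x - v) * χ m x else v, ⟨?_, ?_⟩, ?_⟩
  · intro i j _ k _
    simp only [hv]
  · intro j
    have h1 := hψ j
    have h2 := hχc j
    by_cases hj : j ∈ S
    · simp only [hj, if_true]
      fun_prop
    · simp only [hj, if_false]
      fun_prop
  · intro m hm
    filter_upwards [hχ1 m] with x hx
    simp [hm, hx]

theorem pd_eq {φ : N.J → ℝ → ℝ} {ψ : ℝ → ℝ} {j : N.J} {y p : ℝ} (hy : y ∈ N.edge j)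
    (h : φ j =ᶠ[𝓝 y] ψ) (hp : HasDerivAt ψ p y) :
    DifferentiableWithinAt ℝ (φ j) (N.edge j) y ∧ N.pd φ j y = p := by
  have h1 : HasDerivWithinAt (φ j) p (N.edge j) y :=
    (hp.congr_of_eventuallyEq h).hasDerivWithinAt
  exact ⟨h1.differentiableWithinAt,
    h1.derivWithin (uniqueDiffOn_Icc (N.l_pos j) y hy)⟩

theorem exists_test_interior {j : N.J} {y p : ℝ} (hy : y ∈ Ioo 0 (N.l j)) {ψ : ℝ → ℝ}
    (hψ : Continuous ψ) (hp : HasDerivAt ψ p y) :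
    ∃ φ, N.IsCont φ ∧ DifferentiableWithinAt ℝ (φ j) (N.edge j) y ∧ N.pd φ j y = p ∧
      ∃ δ > 0, ∀ x, |x - y| < δ → φ j x = ψ x := by
  obtain ⟨φ, hφ, he⟩ := exists_isCont_eventuallyEq {j} (fun _ => y) (ψ := fun _ => ψ) 0
    (fun _ => hψ) (fun m _ h => absurd h hy.1.ne')
    (fun m hm h => absurd h (by rw [mem_singleton_iff.1 hm]; exact hy.2.ne))
  obtain ⟨h1, h2⟩ := pd_eq (Ioo_subset_Icc_self hy) (he j rfl) hp
  obtain ⟨δ, hδ, hb⟩ := Metric.eventually_nhds_iff.1 (he j rfl)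
  exact ⟨φ, hφ, h1, h2, δ, hδ, fun x hx => hb hx⟩

theorem exists_test_vertex {i : N.I} {j k : N.J} {p q : ℝ} {ψ : N.J → ℝ → ℝ}
    (hψ : ∀ m, Continuous (ψ m)) (hv : ψ j (N.param i j) = ψ k (N.param i k))
    (hp : HasDerivAt (ψ j) p (N.param i j)) (hq : HasDerivAt (ψ k) q (N.param i k))
    (hpq : N.sgn i j * p + N.sgn i k * q = 0) :
    ∃ φ, N.IsTestJK φ i j k ∧ N.pd φ j (N.param i j) = p ∧
      ∃ δ > 0, (∀ x, |x - N.param i j| < δ → φ j x = ψ j x) ∧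
        ∀ x, |x - N.param i k| < δ → φ k x = ψ k x := by
  have hv' : ∀ m ∈ ({j, k} : Set N.J), ψ m (N.param i m) = ψ j (N.param i j) := by
    rintro m (rfl | rfl)
    exacts [rfl, hv.symm]
  obtain ⟨φ, hφ, he⟩ := exists_isCont_eventuallyEq {j, k} (fun m => N.param i m)
    (ψ := ψ) (ψ j (N.param i j)) hψ (fun m hm h => by rw [← hv' m hm, h])
    (fun m hm h => by rw [← hv' m hm, h])
  have hj := he j (by simp)
  have hk := he k (by simp)
  obtain ⟨h1, h2⟩ := pd_eq (param_mem_edge i j) hj hp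
  obtain ⟨h3, h4⟩ := pd_eq (param_mem_edge i k) hk hq
  obtain ⟨δ, hδ, hb⟩ := Metric.eventually_nhds_iff.1 hj
  obtain ⟨δ', hδ', hb'⟩ := Metric.eventually_nhds_iff.1 hk
  exact ⟨φ, ⟨hφ, h1, h3, by rw [h2, h4, hpq]⟩, h2, min δ δ', lt_min hδ hδ',
    fun x hx => hb (lt_of_lt_of_le hx (min_le_left _ _)),
    fun x hx => hb' (lt_of_lt_of_le hx (min_le_right _ _))⟩

variable {H : N.J → ℝ → ℝ → ℝ → ℝ} {u : N.J → ℝ → ℝ}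

theorem IsSubsol.apply_interior (hu : N.IsSubsol H u) {j : N.J} {y p : ℝ}
    (hy : y ∈ Ioo 0 (N.l j)) {ψ : ℝ → ℝ} (hψ : Continuous ψ) (hp : HasDerivAt ψ p y)
    (hmax : ∀ x ∈ N.edge j, u j x - ψ x ≤ u j y - ψ y) : H j y (u j y) p ≤ 0 := by
  obtain ⟨φ, hφ, hd, rfl, δ, hδ, he⟩ := exists_test_interior hy hψ hp
  refine hu.2.1 j y hy φ hφ hd ⟨δ, hδ, fun x hx hxy => ?_⟩
  rw [he x hxy, he y (by simpa using hδ)]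
  exact hmax x hx

theorem IsSupersol.apply_interior (hu : N.IsSupersol H u) {j : N.J} {y p : ℝ}
    (hy : y ∈ Ioo 0 (N.l j)) {ψ : ℝ → ℝ} (hψ : Continuous ψ) (hp : HasDerivAt ψ p y)
    (hmin : ∀ x ∈ N.edge j, u j y - ψ y ≤ u j x - ψ x) : 0 ≤ H j y (u j y) p := by
  obtain ⟨φ, hφ, hd, rfl, δ, hδ, he⟩ := exists_test_interior hy hψ hp
  refine hu.2.1 j y hy φ hφ hd ⟨δ, hδ, fun x hx hxy => ?_⟩
  rw [he x hxy, he y (by simpa using hδ)]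
  exact hmin x hx

theorem IsSubsol.apply_vertex (hu : N.IsSubsol H u) {i : N.I} (hi : i ∈ N.IT) {j k : N.J}
    (hj : j ∈ N.Inc i) (hk : k ∈ N.Inc i) (hjk : j ≠ k) {p q : ℝ} {ψ : N.J → ℝ → ℝ}
    (hψ : ∀ m, Continuous (ψ m)) (hv : ψ j (N.param i j) = ψ k (N.param i k))
    (hp : HasDerivAt (ψ j) p (N.param i j)) (hq : HasDerivAt (ψ k) q (N.param i k))
    (hpq : N.sgn i j * p + N.sgn i k * q = 0)
    (hmax : ∀ m ∈ N.Inc i, ∀ x ∈ N.edge m,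
      u m x - ψ m x ≤ u m (N.param i m) - ψ m (N.param i m)) :
    H j (N.param i j) (u j (N.param i j)) p ≤ 0 := by
  obtain ⟨φ, hφ, rfl, δ, hδ, hej, hek⟩ := exists_test_vertex hψ hv hp hq hpq
  refine hu.2.2 i hi j hj k hk hjk φ hφ ⟨δ, hδ, fun x hx hxy => ?_, fun x hx hxy => ?_⟩
  · simp only [hej x hxy, hej _ (show |N.param i j - N.param i j| < δ by simpa using hδ)]
    exact hmax j hj x hx
  · simp only [hek x hxy, hek _ (show |N.param i k - N.param i k| < δ by simpa using hδ)]
    exact hmax k hk x hx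

theorem IsSupersol.apply_vertex (hu : N.IsSupersol H u) {i : N.I} (hi : i ∈ N.IT) {j : N.J}
    (hj : j ∈ N.Inc i) : ∃ k ∈ N.Inc i, k ≠ j ∧ ∀ (p q : ℝ) (ψ : N.J → ℝ → ℝ),
    (∀ m, Continuous (ψ m)) → ψ j (N.param i j) = ψ k (N.param i k) →
    HasDerivAt (ψ j) p (N.param i j) → HasDerivAt (ψ k) q (N.param i k) →
    N.sgn i j * p + N.sgn i k * q = 0 →
    (∀ m ∈ N.Inc i, ∀ x ∈ N.edge m,
      u m (N.param i m) - ψ m (N.param i m) ≤ u m x - ψ m x) →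
    0 ≤ H j (N.param i j) (u j (N.param i j)) p := by
  obtain ⟨k, hk, hkj, hH⟩ := hu.2.2 i hi j hj
  refine ⟨k, hk, hkj, fun p q ψ hψ hv hp hq hpq hmin => ?_⟩
  obtain ⟨φ, hφ, rfl, δ, hδ, hej, hek⟩ := exists_test_vertex hψ hv hp hq hpq
  refine hH φ hφ ⟨δ, hδ, fun x hx hxy => ?_, fun x hx hxy => ?_⟩
  · simp only [hej x hxy, hej _ (show |N.param i j - N.param i j| < δ by simpa using hδ)]
    exact hmin j hj x hx
  · simp only [hek x hxy, hek _ (show |N.param i k - N.param i k| < δ by simpa using hδ)]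
    exact hmin k hk x hx

/-- Passage to the limit in the viscosity inequalities produced by doubling of variables. -/
theorem false_of_tendsto_viscosity {g : N.J → ℝ → ℝ} (hH0 : N.H0 H) (hH1 : N.H1 H)
    (hH4 : N.H4 H) (hg : N.IsCont g) (hgneg : ∀ j, ∀ x ∈ N.edge j, g j x < 0)
    {ι : Type*} (F : Ultrafilter ι) {j k : N.J} {a b r s σ : ℝ} (ha : a ∈ N.edge j)
    (hb : b ∈ N.edge k) (hsr : s ≤ r) (hσ : ∀ r p, H k b r (σ * p) = H j a r p)
    {x y R S p q : ι → ℝ} (hx : Tendsto x F (𝓝 a)) (hy : Tendsto y F (𝓝 b))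
    (hR : Tendsto R F (𝓝 r)) (hS : Tendsto S F (𝓝 s)) (hq : Tendsto q F (𝓝 0))
    (hxe : ∀ᶠ n in F, x n ∈ N.edge j) (hye : ∀ᶠ n in F, y n ∈ N.edge k)
    (hsub : ∀ᶠ n in F, H j (x n) (R n) (p n + q n) - g j (x n) ≤ 0)
    (hsup : ∀ᶠ n in F, 0 ≤ H k (y n) (S n) (σ * p n)) : False := by
  obtain ⟨M, hM⟩ := hH4 j (|r| + 1) (by positivity) 0
  have hbound : ∀ᶠ n in F, p n + q n ∈ Icc (-M) M := by
    filter_upwards [hxe, hsub, hR.abs.eventually (eventually_lt_nhds (lt_add_one |r|))]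
      with n h1 h2 h3
    rw [mem_Icc, ← abs_le]
    by_contra! h
    have := hM _ h1 _ h3.le _ h
    linarith [hgneg j _ h1]
  obtain ⟨P, -, hP⟩ := isCompact_Icc.ultrafilter_le_nhds' (F.map fun n => p n + q n) hbound
  replace hP : Tendsto (fun n => p n + q n) F (𝓝 P) := hP
  have hp : Tendsto p F (𝓝 P) := by simpa using hP.sub hq
  have hlim1 : Tendsto (fun n => H j (x n) (R n) (p n + q n)) F (𝓝 (H j a r P)) := by
    refine Tendsto.comp (hH0 j (a, r, P) ⟨ha, mem_univ _, mem_univ _⟩)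
      (tendsto_nhdsWithin_iff.2 ⟨hx.prodMk_nhds (hR.prodMk_nhds hP), ?_⟩)
    exact hxe.mono fun n hn => ⟨hn, mem_univ _, mem_univ _⟩
  have hlim2 : Tendsto (fun n => H k (y n) (S n) (σ * p n)) F (𝓝 (H k b s (σ * P))) := by
    refine Tendsto.comp (hH0 k (b, s, σ * P) ⟨hb, mem_univ _, mem_univ _⟩)
      (tendsto_nhdsWithin_iff.2 ⟨hy.prodMk_nhds (hS.prodMk_nhds (hp.const_mul σ)), ?_⟩)
    exact hye.mono fun n hn => ⟨hn, mem_univ _, mem_univ _⟩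
  have hlimg : Tendsto (fun n => g j (x n)) F (𝓝 (g j a)) :=
    Tendsto.comp (hg.2 j a ha) (tendsto_nhdsWithin_iff.2 ⟨hx, hxe⟩)
  have h1 := le_of_tendsto (hlim1.sub hlimg) hsub
  have h2 := ge_of_tendsto hlim2 hsup
  have h3 := hH1 j a ha P hsr
  beta_reduce at h3
  rw [hσ] at h2
  linarith [hgneg j a ha]

open scoped Classical in
/-- The separation function of the doubling method at the vertex `i`; up to sign it is the
distance between the points `x` of edge `j` and `y` of edge `k` measured through `i`. -/
def vertexGap (N : Network) (i : N.I) (j k : N.J) (x y : ℝ) : ℝ :=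
  if j = k then x - y
  else N.sgn i j * (x - N.param i j) + N.sgn i k * (y - N.param i k)

theorem vertexGap_self (i : N.I) (j : N.J) (x y : ℝ) : N.vertexGap i j j x y = x - y :=
  if_pos rfl

theorem vertexGap_of_ne (i : N.I) {j k : N.J} (h : j ≠ k) (x y : ℝ) : N.vertexGap i j k x y =
    N.sgn i j * (x - N.param i j) + N.sgn i k * (y - N.param i k) :=
  if_neg h

theorem continuous_vertexGap (i : N.I) (j k : N.J) :
    Continuous fun q : ℝ × ℝ => N.vertexGap i j k q.1 q.2 := by
  unfold vertexGap
  split_ifs <;> fun_prop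

open scoped Classical in
/-- The derivative of the gap in its first variable. -/
def gapSlope (N : Network) (i : N.I) (j k : N.J) : ℝ := if j = k then 1 else N.sgn i j

open scoped Classical in
/-- The sign relating the slopes of the gap penalization in its two variables. -/
def gapSign (N : Network) (i : N.I) (j k : N.J) : ℝ :=
  if j = k then 1 else -(N.sgn i j * N.sgn i k)

theorem hasDerivAt_vertexGap_left (i : N.I) (j k : N.J) (x y : ℝ) :
    HasDerivAt (fun x => N.vertexGap i j k x y) (N.gapSlope i j k) x := by
  unfold vertexGap gapSlope
  split_ifs
  · exact (hasDerivAt_id x).sub_const y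
  · simpa using (((hasDerivAt_id x).sub_const (N.param i j)).const_mul
      (N.sgn i j)).add_const (N.sgn i k * (y - N.param i k))

theorem hasDerivAt_vertexGap_right (i : N.I) (j k : N.J) (x y : ℝ) :
    HasDerivAt (fun y => N.vertexGap i j k x y)
      (-(N.gapSign i j k * N.gapSlope i j k)) y := by
  unfold vertexGap gapSlope gapSign
  split_ifs
  · simpa using (hasDerivAt_id y).const_sub x
  · have h := (((hasDerivAt_id y).sub_const (N.param i k)).const_mul
      (N.sgn i k)).const_add (N.sgn i j * (x - N.param i j))
    refine h.congr_deriv ?_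
    linear_combination -N.sgn i k * sgn_mul_self i j

theorem hasDerivAt_penalty_left (i : N.I) (j k : N.J) (t x y : ℝ) :
    HasDerivAt (fun x => t * N.vertexGap i j k x y ^ 2 + (x - N.param i j) ^ 2)
      (2 * t * N.vertexGap i j k x y * N.gapSlope i j k + 2 * (x - N.param i j)) x := by
  have h := (((hasDerivAt_vertexGap_left i j k x y).pow 2).const_mul t).add
    (((hasDerivAt_id x).sub_const (N.param i j)).pow 2)
  refine h.congr_deriv ?_
  simp
  ring

theorem hasDerivAt_penalty_right (i : N.I) (j k : N.J) (t x y : ℝ) :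
    HasDerivAt (fun y => -(t * N.vertexGap i j k x y ^ 2))
      (N.gapSign i j k * (2 * t * N.vertexGap i j k x y * N.gapSlope i j k)) y := by
  have h := (((hasDerivAt_vertexGap_right i j k x y).pow 2).const_mul t).neg
  refine h.congr_deriv ?_
  simp
  ring

theorem gapSign_eq_or (i : N.I) (j k : N.J) :
    N.gapSign i j k = 1 ∨ N.gapSign i j k = -1 := by
  unfold gapSign sgn
  split_ifs <;> simp

theorem vertexGap_param_left_sq (i : N.I) (j k : N.J) (y : ℝ) :
    N.vertexGap i j k (N.param i j) y ^ 2 = (y - N.param i k) ^ 2 := by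
  by_cases h : j = k
  · subst h
    rw [vertexGap_self]
    ring
  · rw [vertexGap_of_ne i h]
    linear_combination (y - N.param i k) ^ 2 * sgn_mul_self i k

theorem vertexGap_param_right_sq (i : N.I) (j k : N.J) (x : ℝ) :
    N.vertexGap i j k x (N.param i k) ^ 2 = (x - N.param i j) ^ 2 := by
  by_cases h : j = k
  · subst h
    rw [vertexGap_self]
  · rw [vertexGap_of_ne i h]
    linear_combination (x - N.param i j) ^ 2 * sgn_mul_self i j

theorem apply_param_sign (hH5 : N.H5 H) (hH6 : N.H6 H) {i : N.I} (hi : i ∈ N.IT) {j k : N.J}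
    (hj : j ∈ N.Inc i) (hk : k ∈ N.Inc i) {σ : ℝ} (hσ : σ = 1 ∨ σ = -1) (r p : ℝ) :
    H k (N.param i k) r (σ * p) = H j (N.param i j) r p := by
  rcases hσ with rfl | rfl
  · rw [one_mul, hH5 i hi j hj k hk]
  · rw [neg_one_mul, ← hH6 i hi k hk, hH5 i hi j hj k hk]

theorem IsSubsol.apply_penalty (hu : N.IsSubsol H u) {i : N.I} (hi : i ∈ N.IT) {j k : N.J}
    (hj : j ∈ N.Inc i) (hk : k ∈ N.Inc i) (hdeg : ∃ m ∈ N.Inc i, m ≠ j) {t x y : ℝ}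
    (hx : x = N.param i j ∨ x ∈ Ioo 0 (N.l j))
    (hmax : ∀ j' ∈ N.Inc i, ∀ x' ∈ N.edge j',
      u j' x' - (t * N.vertexGap i j' k x' y ^ 2 + (x' - N.param i j') ^ 2) ≤
        u j x - (t * N.vertexGap i j k x y ^ 2 + (x - N.param i j) ^ 2)) :
    H j x (u j x)
      (2 * t * N.vertexGap i j k x y * N.gapSlope i j k + 2 * (x - N.param i j)) ≤ 0 := by
  have hc : ∀ m, Continuous fun x =>
      t * N.vertexGap i m k x y ^ 2 + (x - N.param i m) ^ 2 := by
    intro m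
    have := (continuous_vertexGap i m k).comp (Continuous.prodMk_left y)
    simp only [Function.comp_def] at this
    fun_prop
  rcases hx with rfl | hx
  · obtain ⟨m, hm, hmj, hmk⟩ : ∃ m ∈ N.Inc i, m ≠ j ∧ (j ≠ k → m = k) := by
      by_cases h : j = k
      · obtain ⟨m, hm, hmj⟩ := hdeg
        exact ⟨m, hm, hmj, fun h' => absurd h h'⟩
      · exact ⟨k, hk, Ne.symm h, fun _ => rfl⟩
    have hval : ∀ n ∈ N.Inc i, u n (N.param i n) = u j (N.param i j) :=
      fun n hn => hu.1.1 i n hn j hj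
    refine hu.apply_vertex hi hj hm hmj.symm hc ?_ (hasDerivAt_penalty_left i j k t _ y)
      (hasDerivAt_penalty_left i m k t _ y) ?_ ?_
    · simp only [sub_self, vertexGap_param_left_sq]
    · by_cases h : j = k
      · subst h
        simp only [vertexGap_self, vertexGap_of_ne i hmj, gapSlope, if_true, if_neg hmj]
        linear_combination 2 * t * N.sgn i j * (y - N.param i j) * sgn_mul_self i m
      · obtain rfl := hmk h
        simp only [vertexGap_self, vertexGap_of_ne i h, gapSlope, if_true, if_neg h]
        linear_combination 2 * t * N.sgn i m * (y - N.param i m) * sgn_mul_self i j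
    · intro n hn x' hx'
      have := hmax n hn x' hx'
      rwa [vertexGap_param_left_sq, sub_self, ← vertexGap_param_left_sq i n k y,
        ← sub_self (N.param i n), ← hval n hn] at this
  · refine hu.apply_interior hx (hc j) (hasDerivAt_penalty_left i j k t x y) ?_
    exact hmax j hj

theorem IsSupersol.apply_penalty (hu : N.IsSupersol H u) (hH5 : N.H5 H) (hH6 : N.H6 H)
    {i : N.I} (hi : i ∈ N.IT) {j k : N.J} (hj : j ∈ N.Inc i) (hk : k ∈ N.Inc i) {t x y : ℝ}
    (hy : y = N.param i k ∨ y ∈ Ioo 0 (N.l k))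
    (hmin : ∀ k' ∈ N.Inc i, ∀ y' ∈ N.edge k',
      u k y - -(t * N.vertexGap i j k x y ^ 2) ≤
        u k' y' - -(t * N.vertexGap i j k' x y' ^ 2)) :
    0 ≤ H k y (u k y)
      (N.gapSign i j k * (2 * t * N.vertexGap i j k x y * N.gapSlope i j k)) := by
  have hc : ∀ m, Continuous fun y => -(t * N.vertexGap i j m x y ^ 2) := by
    intro m
    have := (continuous_vertexGap i j m).comp (Continuous.prodMk_right x)
    simp only [Function.comp_def] at this
    fun_prop
  rcases hy with rfl | hy
  · obtain ⟨m, hm, hmj, hH⟩ := hu.apply_vertex hi hj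
    have key : 0 ≤ H j (N.param i j) (u j (N.param i j)) (2 * t * (x - N.param i j)) := by
      refine hH _ _ _ hc ?_ (hasDerivAt_penalty_right i j j t x _)
        (hasDerivAt_penalty_right i j m t x _) ?_ ?_ |>.trans_eq ?_
      · simp only [vertexGap_param_right_sq]
      · simp only [vertexGap_self, vertexGap_of_ne i hmj.symm, gapSlope, gapSign, if_true,
          if_neg hmj.symm]
        linear_combination -(2 * t * N.sgn i j * (x - N.param i j)) *
          (N.sgn i m ^ 2 * sgn_mul_self i j + sgn_mul_self i m)
      · intro n hn y' hy'
        have := hmin n hn y' hy'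
        rwa [vertexGap_param_right_sq, ← vertexGap_param_right_sq i j n x,
          hu.1.1 i k hk n hn] at this
      · simp [vertexGap_self, gapSlope, gapSign]
    obtain ⟨σ, hσ, he⟩ : ∃ σ : ℝ, (σ = 1 ∨ σ = -1) ∧
        N.gapSign i j k * (2 * t * N.vertexGap i j k x (N.param i k) * N.gapSlope i j k) =
          σ * (2 * t * (x - N.param i j)) := by
      refine ⟨N.gapSign i j k, gapSign_eq_or i j k, ?_⟩
      by_cases h : j = k
      · subst h
        simp [vertexGap_self, gapSlope]
      · simp only [vertexGap_of_ne i h, gapSlope, if_neg h]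
        linear_combination
          N.gapSign i j k * 2 * t * (x - N.param i j) * sgn_mul_self i j
    rw [he, apply_param_sign hH5 hH6 hi hj hk hσ, hu.1.1 i k hk j hj]
    exact key
  · refine hu.apply_interior hy (hc k) (hasDerivAt_penalty_right i j k t x y) ?_
    exact hmin k hk

theorem not_isMax_vertex {g u₁ u₂ : N.J → ℝ → ℝ} (hH0 : N.H0 H) (hH1 : N.H1 H)
    (hH4 : N.H4 H) (hH5 : N.H5 H) (hH6 : N.H6 H) (hg : N.IsCont g)
    (hgneg : ∀ j, ∀ x ∈ N.edge j, g j x < 0) (hsup : N.IsSupersol H u₁)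
    (hsub : N.IsSubsol (fun j x r p => H j x r p - g j x) u₂) {i : N.I} (hi : i ∈ N.IT)
    {j₀ : N.J} (hj₀ : j₀ ∈ N.Inc i)
    (hpos : u₁ j₀ (N.param i j₀) ≤ u₂ j₀ (N.param i j₀)) :
    ¬ ∀ j, ∀ x ∈ N.edge j,
      u₂ j x - u₁ j x ≤ u₂ j₀ (N.param i j₀) - u₁ j₀ (N.param i j₀) := by
  intro hmax
  let F : Ultrafilter ℕ := Ultrafilter.of atTop
  have hv₁ : ∀ j ∈ N.Inc i, u₁ j (N.param i j) = u₁ j₀ (N.param i j₀) :=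
    fun j hj => hsup.1.1 i j hj j₀ hj₀
  have hv₂ : ∀ j ∈ N.Inc i, u₂ j (N.param i j) = u₂ j₀ (N.param i j₀) :=
    fun j hj => hsub.1.1 i j hj j₀ hj₀
  obtain ⟨j, hj, k, hk, x, y, hev, hx, hy, hux, huy⟩ :=
    exists_seq_isMax_penalized F (Ultrafilter.of_le _) (E := N.Inc i) ⟨j₀, hj₀⟩ (K := N.edge)
      (fun _ => isCompact_Icc) hsub.1.2 hsup.1.2 (a := N.param i)
      (fun j _ => param_mem_edge i j) (fun j hj k hk => by rw [hv₁ k hk, hv₂ j hj])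
      (D := N.vertexGap i) (continuous_vertexGap i)
      (fun j _ k _ => by
        have := vertexGap_param_left_sq i j k (N.param i k)
        simpa using this)
      (fun j hj k hk x hx y hy h => by
        by_cases hjk : j = k
        · subst hjk
          rw [vertexGap_self, sub_eq_zero] at h
          subst h
          exact hmax j x hx
        · rw [vertexGap_of_ne i hjk] at h
          have h1 := sgn_mul_sub_param_nonneg i hx
          have h2 := sgn_mul_sub_param_nonneg i hy
          have h3 := vertexGap_param_left_sq i j k y
          have h4 := vertexGap_param_right_sq i j k x
          rw [vertexGap_of_ne i hjk] at h3 h4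
          have hx0 : x = N.param i j := by
            rw [sub_self, mul_zero, add_zero, show N.sgn i j * (x - N.param i j) = 0 by
              linarith] at h4
            exact sub_eq_zero.1 (pow_eq_zero_iff two_ne_zero |>.1 (by linarith))
          have hy0 : y = N.param i k := by
            rw [sub_self, mul_zero, zero_add, show N.sgn i k * (y - N.param i k) = 0 by
              linarith] at h3
            exact sub_eq_zero.1 (pow_eq_zero_iff two_ne_zero |>.1 (by linarith))
          rw [hx0, hy0, hv₁ k hk, hv₂ j hj])
      (fun j _ k _ y h => by
        have := vertexGap_param_left_sq i j k y
        rw [h] at this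
        exact sub_eq_zero.1 (pow_eq_zero_iff two_ne_zero |>.1 (by linarith)))
  have hdeg : ∃ m ∈ N.Inc i, m ≠ j := by
    obtain ⟨m, hm, hmj, -⟩ := hsup.2.2 i hi j hj
    exact ⟨m, hm, hmj⟩
  refine false_of_tendsto_viscosity hH0 hH1 hH4 hg hgneg F (param_mem_edge i j)
    (param_mem_edge i k) (s := u₁ k (N.param i k)) (r := u₂ j (N.param i j)) ?_
    (apply_param_sign hH5 hH6 hi hj hk (gapSign_eq_or i j k)) hx hy hux huy
    (p := fun n : ℕ => 2 * n * N.vertexGap i j k (x n) (y n) * N.gapSlope i j k)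
    (q := fun n => 2 * (x n - N.param i j)) ?_ (hev.mono fun n hn => hn.1)
    (hev.mono fun n hn => hn.2.1) ?_ ?_
  · rw [hv₁ k hk, hv₂ j hj]
    exact hpos
  · simpa using (hx.sub_const (N.param i j)).const_mul 2
  · filter_upwards [hev, hx.eventually (eventually_eq_param_or_mem_Ioo i j)] with n hn hn'
    refine hsub.apply_penalty hi hj hk hdeg (hn' hn.1) fun j' hj' x' hx' => ?_
    have := hn.2.2 j' hj' k hk x' hx' (y n) hn.2.1
    linarith
  · filter_upwards [hev, hy.eventually (eventually_eq_param_or_mem_Ioo i k)] with n hn hn'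
    refine hsup.apply_penalty hH5 hH6 hi hj hk (hn' hn.2.1) fun k' hk' y' hy' => ?_
    have := hn.2.2 j hj k' hk' (x n) hn.1 y' hy'
    linarith

theorem not_isMax_interior {g u₁ u₂ : N.J → ℝ → ℝ} (hH0 : N.H0 H) (hH1 : N.H1 H)
    (hH4 : N.H4 H) (hg : N.IsCont g) (hgneg : ∀ j, ∀ x ∈ N.edge j, g j x < 0)
    (hsup : N.IsSupersol H u₁)
    (hsub : N.IsSubsol (fun j x r p => H j x r p - g j x) u₂) {j : N.J} {z : ℝ}
    (hz : z ∈ Ioo 0 (N.l j)) (hpos : u₁ j z ≤ u₂ j z) :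
    ¬ ∀ x ∈ N.edge j, u₂ j x - u₁ j x ≤ u₂ j z - u₁ j z := by
  intro hmax
  let F : Ultrafilter ℕ := Ultrafilter.of atTop
  have hze : z ∈ N.edge j := Ioo_subset_Icc_self hz
  obtain ⟨-, -, -, -, x, y, hev, hx, hy, hux, huy⟩ :=
    exists_seq_isMax_penalized (J := Unit) F (Ultrafilter.of_le _) (E := univ) univ_nonempty
      (K := fun _ => N.edge j) (fun _ => isCompact_Icc) (fun _ => hsub.1.2 j)
      (fun _ => hsup.1.2 j) (a := fun _ => z) (fun _ _ => hze) (fun _ _ _ _ => rfl)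
      (D := fun _ _ x y => x - y) (fun _ _ => by fun_prop) (fun _ _ _ _ => sub_self z)
      (fun _ _ _ _ x hx y _ h => by
        obtain rfl := sub_eq_zero.1 h
        exact hmax x hx)
      (fun _ _ _ _ y h => (sub_eq_zero.1 h).symm)
  have hIoo : ∀ᶠ x in 𝓝 z, x ∈ Ioo 0 (N.l j) := Ioo_mem_nhds hz.1 hz.2
  refine false_of_tendsto_viscosity hH0 hH1 hH4 hg hgneg F hze hze hpos (σ := 1)
    (fun r p => by rw [one_mul]) hx hy hux huy (p := fun n : ℕ => 2 * n * (x n - y n))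
    (q := fun n => 2 * (x n - z)) ?_ (hev.mono fun n hn => hn.1)
    (hev.mono fun n hn => hn.2.1) ?_ ?_
  · simpa using (hx.sub_const z).const_mul 2
  · filter_upwards [hev, hx.eventually hIoo] with n hn hn'
    refine hsub.apply_interior hn' (ψ := fun x => n * (x - y n) ^ 2 + (x - z) ^ 2)
      (by fun_prop) ?_ fun x' hx' => ?_
    · refine HasDerivAt.congr_deriv (((((hasDerivAt_id (x n)).sub_const (y n)).pow 2).const_mul
        (n : ℝ)).add (((hasDerivAt_id (x n)).sub_const z).pow 2)) ?_
      simp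
      ring
    · have := hn.2.2 () trivial () trivial x' hx' (y n) hn.2.1
      linarith
  · filter_upwards [hev, hy.eventually hIoo] with n hn hn'
    refine hsup.apply_interior hn' (ψ := fun y => -(n * (x n - y) ^ 2))
      (by fun_prop) ?_ fun y' hy' => ?_
    · refine HasDerivAt.congr_deriv ((((hasDerivAt_id (y n)).const_sub (x n)).pow 2).const_mul
        (n : ℝ)).neg ?_
      simp
      ring
    · have := hn.2.2 () trivial () trivial (x n) hn.1 y' hy'
      linarith

/-- An upper semicontinuous minus a lower semicontinuous function attains its maximum. -/
theorem exists_max_sub {u₁ u₂ : N.J → ℝ → ℝ} (h₁ : N.IsLSC u₁) (h₂ : N.IsUSC u₂) :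
    ∃ j, ∃ z ∈ N.edge j, ∀ j', ∀ x ∈ N.edge j', u₂ j' x - u₁ j' x ≤ u₂ j z - u₁ j z := by
  have h : ∀ j, ∃ z ∈ N.edge j, ∀ x ∈ N.edge j, u₂ j x - u₁ j x ≤ u₂ j z - u₁ j z := by
    intro j
    have hu : UpperSemicontinuousOn (fun x => u₂ j x + - u₁ j x) (N.edge j) :=
      (h₂.2 j).add (continuous_neg.comp_lowerSemicontinuousOn_antitone (h₁.2 j)
        fun x y hxy => neg_le_neg hxy)
    obtain ⟨z, hz, hmax⟩ := hu.exists_isMaxOn (nonempty_Icc.2 (N.l_pos j).le) isCompact_Icc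
    refine ⟨z, hz, fun x hx => ?_⟩
    have := isMaxOn_iff.1 hmax x hx
    linarith
  choose z hz hmax using h
  obtain ⟨j, hj⟩ := Finite.exists_max fun j => u₂ j (z j) - u₁ j (z j)
  exact ⟨j, z j, hz j, fun j' x hx => (hmax j' x hx).trans (hj j')⟩

/-- Every point of an edge is an interior point or a vertex. -/
theorem mem_Ioo_or_eq_param {j : N.J} {z : ℝ} (hz : z ∈ N.edge j) :
    z ∈ Ioo 0 (N.l j) ∨ ∃ i, j ∈ N.Inc i ∧ z = N.param i j := by
  rcases hz.1.eq_or_lt with h0 | h0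
  · exact Or.inr ⟨N.s j, Or.inl rfl, by simp [param, ← h0]⟩
  rcases hz.2.eq_or_lt with hl | hl
  · exact Or.inr ⟨N.t j, Or.inr rfl, by simp [param, hl, N.st_ne j]⟩
  · exact Or.inl ⟨h0, hl⟩

end Network

end

open Network in
/-- **Theorem 2.9(b)** (comparison principle for viscosity solutions with strictly
separated right-hand sides). -/
theorem viscosity_comparison_separated
    (N : Network) (H : N.J → ℝ → ℝ → ℝ → ℝ)
    (hH0 : N.H0 H) (hH1 : N.H1 H) (hH3 : N.H3 H) (hH4 : N.H4 H)
    (hH5 : N.H5 H) (hH6 : N.H6 H)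
    (g : N.J → ℝ → ℝ) (hg : N.IsCont g)
    (hgneg : ∀ j, ∀ x ∈ N.edge j, g j x < 0)
    (u₁ u₂ : N.J → ℝ → ℝ)
    (hsup : N.IsSupersol H u₁)
    (hsub : N.IsSubsol (fun j x r p => H j x r p - g j x) u₂)
    (hbd : ∀ i ∈ N.IB, ∀ j ∈ N.Inc i, u₂ j (N.param i j) ≤ u₁ j (N.param i j)) :
    ∀ j, ∀ x ∈ N.edge j, u₂ j x ≤ u₁ j x := by
  by_contra! hlt
  obtain ⟨j, x, hx, hlt⟩ := hlt
  obtain ⟨j₀, z, hz, hmax⟩ := exists_max_sub hsup.1 hsub.1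
  have hpos : u₁ j₀ z < u₂ j₀ z := by
    have := hmax j x hx
    linarith
  rcases mem_Ioo_or_eq_param hz with hz' | ⟨i, hi, rfl⟩
  · exact not_isMax_interior hH0 hH1 hH4 hg hgneg hsup hsub hz' hpos.le (hmax j₀)
  · have hiT : i ∈ N.IT := fun hB => (hbd i hB j₀ hi).not_gt hpos
    exact not_isMax_vertex hH0 hH1 hH4 hH5 hH6 hg hgneg hsup hsub hiT hi hpos.le hmax
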